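/- Let Ω be a body in ℝ^m. Suppose there exist p (1 ≤ p ≤ m) linearly independent unit vectors v₁, …, v_p ∈ S^{m−1} such that, for each j, Ω is symmetric in the hyperplane v_j^⊥ (i.e., Refl_{v_j,0}(Ω) = Ω) and Ω is convex in the direction v_j. Then Uf(Ω) ⊆ ⋂_{j=1}^{p} v_j^⊥. -/

import Mathlib

open Set MeasureTheory Filter Asymptotics Metric
open scoped Topology RealInnerProductSpace

noncomputable section

/-- `m`-dimensional Euclidean space. -/
abbrev Euc (m : ℕ) := EuclideanSpace ℝ (Fin m)

/-- A body: the closure of a nonempty bounded open set. -/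
def IsBody {m : ℕ} (Ω : Set (Euc m)) : Prop :=
  ∃ U : Set (Euc m), IsOpen U ∧ U.Nonempty ∧ Bornology.IsBounded U ∧ Ω = closure U

/-- The potential `K_Ω(x) = ∫_Ω k(|x - y|) dy`. -/
def pot {m : ℕ} (k : ℝ → ℝ) (Ω : Set (Euc m)) (x : Euc m) : ℝ :=
  ∫ y in Ω, k (dist x y)

/-- Condition `(C⁰_α)`. -/
def CondC0 (m : ℕ) (α : ℝ) (k : ℝ → ℝ) : Prop :=
  ContinuousOn k (Ioi 0) ∧
  (α < m → k =O[𝓝[>] (0:ℝ)] fun r : ℝ => r ^ (α - m)) ∧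
  (α = m → k =O[𝓝[>] (0:ℝ)] fun r : ℝ => Real.log r) ∧
  ((m : ℝ) < α → k =O[𝓝[>] (0:ℝ)] fun _ : ℝ => (1:ℝ))

/-- Condition `(C¹_α)`. -/
def CondC1 (m : ℕ) (α : ℝ) (k : ℝ → ℝ) : Prop :=
  ContDiffOn ℝ 1 k (Ioi 0) ∧
  (α < m → k =O[𝓝[>] (0:ℝ)] fun r : ℝ => r ^ (α - m)) ∧
  (α = m → k =O[𝓝[>] (0:ℝ)] fun r : ℝ => Real.log r) ∧
  ((m : ℝ) < α → k =O[𝓝[>] (0:ℝ)] fun _ : ℝ => (1:ℝ)) ∧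
  (α < m + 1 → deriv k =O[𝓝[>] (0:ℝ)] fun r : ℝ => r ^ (α - m - 1)) ∧
  (α = m + 1 → deriv k =O[𝓝[>] (0:ℝ)] fun r : ℝ => Real.log r) ∧
  ((m : ℝ) + 1 < α → deriv k =O[𝓝[>] (0:ℝ)] fun _ : ℝ => (1:ℝ))

/-- Reflection of `ℝ^m` in the hyperplane `{z : z ⬝ v = b}` (for a unit vector `v`). -/
def reflAt {m : ℕ} (v : Euc m) (b : ℝ) (z : Euc m) : Euc m :=
  z + (2 * (b - ⟪z, v⟫)) • v

/-- `Ω⁺_{v,b}`, the part of `Ω` of height at least `b` in direction `v`. -/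
def upSet {m : ℕ} (Ω : Set (Euc m)) (v : Euc m) (b : ℝ) : Set (Euc m) :=
  {z ∈ Ω | b ≤ ⟪z, v⟫}

/-- The minimum folding height `l(v)`. -/
def foldHeight {m : ℕ} (Ω : Set (Euc m)) (v : Euc m) : ℝ :=
  sInf {a : ℝ | ∀ b ≥ a, reflAt v b '' upSet Ω v b ⊆ Ω}

/-- The minimal unfolded region `Uf(Ω)`. -/
def unfolded {m : ℕ} (Ω : Set (Euc m)) : Set (Euc m) :=
  ⋂ v ∈ sphere (0 : Euc m) 1, {z : Euc m | ⟪z, v⟫ ≤ foldHeight Ω v}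

/-- `Ω` is convex in the direction `v`: every line parallel to `v` meets `Ω` in a connected set. -/
def ConvexInDir {m : ℕ} (Ω : Set (Euc m)) (v : Euc m) : Prop :=
  ∀ z : Euc m, ⟪z, v⟫ = 0 → IsPreconnected (Ω ∩ {w : Euc m | ∃ t : ℝ, w = z + t • v})

/-- `d(Ω) = min {|z - w| : z ∈ Uf(Ω), w ∈ ∂Ω}`. -/
def dMin {m : ℕ} (Ω : Set (Euc m)) : ℝ :=
  sInf {d : ℝ | ∃ z ∈ unfolded Ω, ∃ w ∈ frontier Ω, d = dist z w}

/-- `D(Ω) = max {|z - w| : z ∈ Uf(Ω), w ∈ ∂Ω}`. -/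
def dMax {m : ℕ} (Ω : Set (Euc m)) : ℝ :=
  sSup {d : ℝ | ∃ z ∈ unfolded Ω, ∃ w ∈ frontier Ω, d = dist z w}

/-- The `r^{α-m}`-potential `V^{(α)}_Ω`. -/
def rpot (m : ℕ) (α : ℝ) (Ω : Set (Euc m)) (x : Euc m) : ℝ :=
  if α = (m : ℝ) then -∫ y in Ω, Real.log (dist x y)
  else Real.sign ((m : ℝ) - α) * ∫ y in Ω, dist x y ^ (α - (m : ℝ))

/-- The solid-angle (Poisson) potential `A_Ω(x, h)`. -/
def apot (m : ℕ) (Ω : Set (Euc m)) (x : Euc m) (h : ℝ) : ℝ :=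
  ∫ y in Ω, h / (dist x y ^ 2 + h ^ 2) ^ (((m : ℝ) + 1) / 2)

/-- Reversing the normal vector reverses the height of the mirror. -/
theorem reflAt_neg {m : ℕ} (v : Euc m) (b : ℝ) : reflAt (-v) b = reflAt v (-b) := by
  funext z
  simp only [reflAt, inner_neg_right, smul_neg, ← neg_smul]
  congr 2
  ring

theorem ConvexInDir.neg {m : ℕ} {Ω : Set (Euc m)} {v : Euc m} (h : ConvexInDir Ω v) :
    ConvexInDir Ω (-v) := by
  intro z hz
  have hline : {w : Euc m | ∃ t : ℝ, w = z + t • -v} = {w : Euc m | ∃ t : ℝ, w = z + t • v} := by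
    ext w
    constructor
    · rintro ⟨t, rfl⟩
      exact ⟨-t, by simp⟩
    · rintro ⟨t, rfl⟩
      exact ⟨-t, by simp⟩
  rw [hline]
  exact h z (by simpa using hz)

theorem IsBody.nonempty {m : ℕ} {Ω : Set (Euc m)} (hΩ : IsBody Ω) : Ω.Nonempty := by
  obtain ⟨U, -, hne, -, rfl⟩ := hΩ
  exact hne.closure

theorem IsBody.isBounded {m : ℕ} {Ω : Set (Euc m)} (hΩ : IsBody Ω) : Bornology.IsBounded Ω := by
  obtain ⟨U, -, -, hb, rfl⟩ := hΩ
  exact hb.closure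

theorem inner_reflAt {m : ℕ} {v : Euc m} (hv : ‖v‖ = 1) (b : ℝ) (z : Euc m) :
    ⟪reflAt v b z, v⟫ = 2 * b - ⟪z, v⟫ := by
  simp only [reflAt, inner_add_left, real_inner_smul_left, real_inner_self_eq_norm_sq, hv]
  ring

theorem bddBelow_foldHeight_set {m : ℕ} {Ω : Set (Euc m)} (hne : Ω.Nonempty)
    (hbdd : Bornology.IsBounded Ω) {v : Euc m} (hv : ‖v‖ = 1) :
    BddBelow {a : ℝ | ∀ b ≥ a, reflAt v b '' upSet Ω v b ⊆ Ω} := by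
  obtain ⟨R, hR⟩ := hbdd.exists_norm_le
  have habs : ∀ z ∈ Ω, |⟪z, v⟫| ≤ R := fun z hz =>
    (abs_real_inner_le_norm z v).trans (by simpa [hv] using hR z hz)
  refine ⟨-R, fun a ha => ?_⟩
  by_contra! hlt
  obtain ⟨z, hz⟩ := hne
  have hz' := abs_le.1 (habs z hz)
  have hmem : reflAt v a z ∈ Ω := ha a le_rfl ⟨z, ⟨hz, by linarith⟩, rfl⟩
  have hw := (abs_le.1 (habs _ hmem)).1
  rw [inner_reflAt hv] at hw
  linarith

/-- In a direction of convexity, folding a symmetric set at nonnegative height stays inside. -/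
theorem reflAt_image_upSet_subset {m : ℕ} {Ω : Set (Euc m)} {v : Euc m} (hv : ‖v‖ = 1)
    (hsymm : reflAt v 0 '' Ω = Ω) (hconv : ConvexInDir Ω v) {b : ℝ} (hb : 0 ≤ b) :
    reflAt v b '' upSet Ω v b ⊆ Ω := by
  rintro _ ⟨z, ⟨hz, hzb⟩, rfl⟩
  have hvv : ⟪v, v⟫ = 1 := by rw [real_inner_self_eq_norm_sq, hv, one_pow]
  set s := ⟪z, v⟫ with hs
  have hperp : ⟪z - s • v, v⟫ = 0 := by
    rw [inner_sub_left, real_inner_smul_left, hvv, ← hs]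
    ring
  have hrefl : reflAt v 0 z ∈ Ω := hsymm ▸ mem_image_of_mem _ hz
  have hheight := ((hconv _ hperp).image (fun w => ⟪w, v⟫) (by fun_prop)).ordConnected
  have hlow : -s ∈ (fun w => ⟪w, v⟫) '' (Ω ∩ {w | ∃ t : ℝ, w = z - s • v + t • v}) := by
    refine ⟨reflAt v 0 z, ⟨hrefl, -s, ?_⟩, ?_⟩
    · rw [reflAt, ← hs]
      module
    · simp [inner_reflAt hv, hs]
  have hhigh : s ∈ (fun w => ⟪w, v⟫) '' (Ω ∩ {w | ∃ t : ℝ, w = z - s • v + t • v}) :=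
    ⟨z, ⟨hz, s, by module⟩, rfl⟩
  obtain ⟨w, ⟨hw, t, hwt⟩, hws⟩ :=
    hheight.out hlow hhigh (show 2 * b - s ∈ Icc (-s) s from ⟨by linarith, by linarith⟩)
  have ht : t = 2 * b - s := by
    rw [← hws, hwt]
    simp only [inner_add_left, hperp, real_inner_smul_left, hvv]
    ring
  have hwz : w = reflAt v b z := by
    rw [hwt, ht, reflAt, ← hs]
    module
  exact hwz ▸ hw

theorem foldHeight_nonpos {m : ℕ} {Ω : Set (Euc m)} (hΩ : IsBody Ω) {v : Euc m} (hv : ‖v‖ = 1)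
    (hsymm : reflAt v 0 '' Ω = Ω) (hconv : ConvexInDir Ω v) : foldHeight Ω v ≤ 0 :=
  csInf_le (bddBelow_foldHeight_set hΩ.nonempty hΩ.isBounded hv)
    fun _ hb => reflAt_image_upSet_subset hv hsymm hconv hb

/-- symmetry and directional convexity confine the minimal unfolded region to the
intersection of the symmetry hyperplanes. -/
theorem unfolded_subset_of_symmetries {m : ℕ} (Ω : Set (Euc m)) (hΩ : IsBody Ω)
    (p : ℕ) (hp1 : 1 ≤ p) (hpm : p ≤ m) (v : Fin p → Euc m)
    (hindep : LinearIndependent ℝ v) (hunit : ∀ j, v j ∈ sphere (0 : Euc m) 1)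
    (hsymm : ∀ j, reflAt (v j) 0 '' Ω = Ω)
    (hconv : ∀ j, ConvexInDir Ω (v j)) :
    unfolded Ω ⊆ ⋂ j : Fin p, {z : Euc m | ⟪z, v j⟫ = 0} := by
  intro z hz
  simp only [unfolded, mem_iInter, mem_ofPred_eq] at hz ⊢
  intro j
  have hv : ‖v j‖ = 1 := by simpa using hunit j
  have hneg : ‖-v j‖ = 1 := by rw [norm_neg, hv]
  have hsymm_neg : reflAt (-v j) 0 '' Ω = Ω := by rw [reflAt_neg, neg_zero, hsymm j]
  have hupper := (hz (v j) (hunit j)).trans (foldHeight_nonpos hΩ hv (hsymm j) (hconv j))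
  have hlower := (hz (-v j) (by simpa using hneg)).trans
    (foldHeight_nonpos hΩ hneg hsymm_neg (hconv j).neg)
  rw [inner_neg_right] at hlower
  linarith
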